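/- Let G be a countable amenable group, X a compact metric space, Ω a singleton, and suppose the action of G on 𝓔 (equivalently, the topological action G ↷ K on the nonempty compact set K ⊆ X determined by the trivial RDS) is transitive. Then the set 𝔼 of Weyl-mean equicontinuous points of the action G ↷ K is either empty or residual in K; and if, in addition, the action G ↷ K is almost Weyl-mean equicontinuous (i.e. 𝔼 ≠ ∅), then every transitive point of G ↷ K is a Weyl-mean equicontinuous point. -/

import Mathlib

open Filter MeasureTheory Topology Metric Set ENNReal
open scoped symmDiff Classical

/-- `Φ` is a (left) Følner sequence of nonempty finite subsets of `G`. -/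
def IsFolner {G : Type*} [Group G] (Φ : ℕ → Finset G) : Prop :=
  (∀ n, (Φ n).Nonempty) ∧
    ∀ g : G,
      Tendsto (fun n => ((((Φ n).image fun t => g * t) ∆ Φ n).card : ℝ) / ((Φ n).card : ℝ))
        atTop (𝓝 0)

/-- The upper Banach density `BD*(E)` of a subset `E` of an amenable group `G`. -/
noncomputable def upperBanachDensity {G : Type*} [Group G] (E : Set G) : ℝ≥0∞ :=
  ⨆ (Φ : ℕ → Finset G) (_ : IsFolner Φ),
    Filter.limsup
      (fun n => (((Φ n).filter fun g => g ∈ E).card : ℝ≥0∞) / ((Φ n).card : ℝ≥0∞)) atTop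

/-- A continuous bundle random dynamical system over the measure-preserving dynamical
system given by the measure-preserving action of `G` on the probability space `(Ω, μ)`,
with fibers `E ω ⊆ X` and fiber maps `F g ω : E ω → E (g • ω)`. -/
structure RDS (G : Type*) [Group G] (Ω : Type*) [MeasurableSpace Ω] [MulAction G Ω]
    (μ : Measure Ω) (X : Type*) [MetricSpace X] [MeasurableSpace X] [BorelSpace X] where
  E : Ω → Set X
  F : G → Ω → X → X
  measurePreserving_smul : ∀ g : G, MeasurePreserving (fun ω : Ω => g • ω) μ μ
  measurableSet_carrier : MeasurableSet {p : Ω × X | p.2 ∈ E p.1}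
  mapsTo : ∀ (g : G) (ω : Ω), Set.MapsTo (F g ω) (E ω) (E (g • ω))
  one_apply : ∀ (ω : Ω), ∀ x ∈ E ω, F 1 ω x = x
  measurable_F : ∀ g : G, Measurable fun p : {p : Ω × X // p.2 ∈ E p.1} => F g p.1.1 p.1.2
  cocycle : ∀ (g₁ g₂ : G) (ω : Ω), ∀ x ∈ E ω, F g₂ (g₁ • ω) (F g₁ ω x) = F (g₂ * g₁) ω x
  ae_fiber : ∀ᵐ ω ∂μ, (E ω).Nonempty ∧ IsCompact (E ω) ∧ ∀ g : G, ContinuousOn (F g ω) (E ω)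

namespace RDS

variable {G : Type*} [Group G] {Ω : Type*} [MeasurableSpace Ω] [MulAction G Ω]
  {μ : Measure Ω} {X : Type*} [MetricSpace X] [MeasurableSpace X] [BorelSpace X]
  (S : RDS G Ω μ X)

/-- The carrier `𝓔 ⊆ Ω × X` of the RDS. -/
def carrier : Set (Ω × X) := {p : Ω × X | p.2 ∈ S.E p.1}

/-- `d̃(tx, ty) := sup_ω d(F_{t,ω} x, F_{t,ω} y)` when `x, y` lie in a common fiber,
and `∞` otherwise. -/
noncomputable def dt (t : G) (x y : X) : ℝ≥0∞ :=
  if ∃ ω : Ω, x ∈ S.E ω ∧ y ∈ S.E ω then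
    ⨆ ω ∈ {ω : Ω | x ∈ S.E ω ∧ y ∈ S.E ω}, edist (S.F t ω x) (S.F t ω y)
  else ⊤

/-- `D^{(r)}_𝓕(x,y) := limsup_n (1/|Φ n|) Σ_{t ∈ Φ n} d̃(tx,ty)`. -/
noncomputable def DFol (Φ : ℕ → Finset G) (x y : X) : ℝ≥0∞ :=
  Filter.limsup (fun n => (∑ t ∈ Φ n, S.dt t x y) / ((Φ n).card : ℝ≥0∞)) atTop

/-- The Weyl pseudometric `D^{(r)}(x,y)`, the sup over all Følner sequences. -/
noncomputable def DW (x y : X) : ℝ≥0∞ :=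
  ⨆ (Φ : ℕ → Finset G) (_ : IsFolner Φ), S.DFol Φ x y

/-- The Banach pseudometric `D̄^{(r)}(x,y) := inf_K sup_g (1/|K|) Σ_{t ∈ Kg} d̃(tx,ty)`. -/
noncomputable def DB (x y : X) : ℝ≥0∞ :=
  ⨅ (K : Finset G) (_ : K.Nonempty),
    ⨆ g : G, (∑ t ∈ K.image fun k => k * g, S.dt t x y) / ((K.card : ℝ≥0∞))

/-- Weyl-mean equicontinuity of the RDS. -/
def WME : Prop :=
  ∀ ε : ℝ, 0 < ε → ∃ δ : ℝ, 0 < δ ∧ ∀ (ω : Ω) (x y : X),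
    x ∈ S.E ω → y ∈ S.E ω → dist x y < δ → S.DW x y < ENNReal.ofReal ε

/-- Banach-mean equicontinuity of the RDS. -/
def BME : Prop :=
  ∀ ε : ℝ, 0 < ε → ∃ δ : ℝ, 0 < δ ∧ ∀ (ω : Ω) (x y : X),
    x ∈ S.E ω → y ∈ S.E ω → dist x y < δ → S.DB x y < ENNReal.ofReal ε

/-- Mean-L-stability: points starting close stay `ε`-close outside a set of
upper Banach density less than `ε`. -/
def MeanLStable : Prop :=
  ∀ ε : ℝ, 0 < ε → ∃ δ : ℝ, 0 < δ ∧ ∀ (ω : Ω) (x y : X),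
    x ∈ S.E ω → y ∈ S.E ω → dist x y < δ →
      upperBanachDensity {g : G | ENNReal.ofReal ε ≤ S.dt g x y} < ENNReal.ofReal ε

/-- `Ĥ^{(r)}_{𝓕,ω}(x,y)`. -/
noncomputable def HFol (Φ : ℕ → Finset G) (ω : Ω) (x y : X) : ℝ≥0∞ :=
  if x ∈ S.E ω ∧ y ∈ S.E ω then
    Filter.limsup
      (fun n => (∑ t ∈ Φ n, edist (S.F t ω x) (S.F t ω y)) / ((Φ n).card : ℝ≥0∞)) atTop
  else ⊤

/-- `Ĥ^{(r)}_ω(x,y)`, the sup over all Følner sequences of `Ĥ^{(r)}_{𝓕,ω}(x,y)`. -/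
noncomputable def HW (ω : Ω) (x y : X) : ℝ≥0∞ :=
  ⨆ (Φ : ℕ → Finset G) (_ : IsFolner Φ), S.HFol Φ ω x y

/-- `Ĥ^{(r)}(x,y) := sup_ω Ĥ^{(r)}_ω(x,y)`. -/
noncomputable def Hsup (x y : X) : ℝ≥0∞ := ⨆ ω : Ω, S.HW ω x y

/-- Weyl-mean sensitivity of the RDS. -/
def WeylMeanSensitive : Prop :=
  ∃ δ : ℝ, 0 < δ ∧ ∀ (x : X) (ε : ℝ), 0 < ε →
    ∃ (ω : Ω) (y : X), y ∈ S.E ω ∩ Metric.ball x ε ∧ ENNReal.ofReal δ < S.HW ω x y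

/-- The set `𝔼_{ω,ε}` of points of `E ω` around which the Weyl pseudometric is
uniformly `< ε` on a small relative ball. -/
def EE (ω : Ω) (ε : ℝ) : Set X :=
  {x ∈ S.E ω | ∃ δ : ℝ, 0 < δ ∧
    ∀ y ∈ Metric.ball x δ ∩ S.E ω, ∀ z ∈ Metric.ball x δ ∩ S.E ω,
      S.DW y z < ENNReal.ofReal ε}

/-- The set `𝔼` of Weyl-mean equicontinuous points of the RDS. -/
def meanEqPts : Set X :=
  {x : X | ∀ ε : ℝ, 0 < ε → ∃ δ : ℝ, 0 < δ ∧ ∀ (ω : Ω) (y : X),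
    y ∈ S.E ω → dist x y < δ → S.DW x y < ENNReal.ofReal ε}

end RDS

/-- `D_𝓕(x,y)` for a (deterministic) group action `T` of `G` on `K`. -/
noncomputable def actDFol {G K : Type*} [Group G] [PseudoMetricSpace K]
    (T : G → K → K) (Φ : ℕ → Finset G) (x y : K) : ℝ≥0∞ :=
  Filter.limsup (fun n => (∑ t ∈ Φ n, edist (T t x) (T t y)) / ((Φ n).card : ℝ≥0∞)) atTop

/-- The Weyl pseudometric `D(x,y)` for a group action. -/
noncomputable def actDW {G K : Type*} [Group G] [PseudoMetricSpace K]
    (T : G → K → K) (x y : K) : ℝ≥0∞ :=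
  ⨆ (Φ : ℕ → Finset G) (_ : IsFolner Φ), actDFol T Φ x y

/-- The Banach pseudometric `D̄(x,y)` for a group action. -/
noncomputable def actDB {G K : Type*} [Group G] [PseudoMetricSpace K]
    (T : G → K → K) (x y : K) : ℝ≥0∞ :=
  ⨅ (F : Finset G) (_ : F.Nonempty),
    ⨆ g : G, (∑ t ∈ F.image fun k => k * g, edist (T t x) (T t y)) / ((F.card : ℝ≥0∞))

/-- The set of Weyl-mean equicontinuous points of a group action. -/
def actMeanEqPts {G K : Type*} [Group G] [PseudoMetricSpace K]
    (T : G → K → K) : Set K :=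
  {x : K | ∀ ε : ℝ, 0 < ε → ∃ δ : ℝ, 0 < δ ∧
    ∀ y : K, dist x y < δ → actDW T x y < ENNReal.ofReal ε}

/-- Right translates of Følner sequences are Følner sequences. -/
theorem IsFolner.image_mul_right {G : Type*} [Group G] {Φ : ℕ → Finset G} (hΦ : IsFolner Φ)
    (g : G) : IsFolner fun n => (Φ n).image fun t => t * g := by
  have hinj : Function.Injective fun t : G => t * g := mul_left_injective g
  refine ⟨fun n => (hΦ.1 n).image _, fun h => (hΦ.2 h).congr fun n => ?_⟩
  have hcomm : (((Φ n).image fun t => t * g).image fun t => h * t) =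
      ((Φ n).image fun t => h * t).image fun t => t * g := by
    simp only [Finset.image_image, Function.comp_def, mul_assoc]
  rw [hcomm, ← Finset.image_symmDiff _ _ hinj, Finset.card_image_of_injective _ hinj,
    Finset.card_image_of_injective _ hinj]

section WeylPseudometric

variable {G K : Type*} [Group G] [PseudoMetricSpace K] {T : G → K → K}

theorem actDFol_le_actDW {Φ : ℕ → Finset G} (hΦ : IsFolner Φ) (x y : K) :
    actDFol T Φ x y ≤ actDW T x y :=
  le_iSup₂_of_le Φ hΦ le_rfl

theorem actDW_comm (x y : K) : actDW T x y = actDW T y x := by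
  simp only [actDW, actDFol, edist_comm]

theorem actDW_apply_le (hTmul : ∀ (g₁ g₂ : G) (x : K), T g₂ (T g₁ x) = T (g₂ * g₁) x)
    (g : G) (x y : K) : actDW T (T g x) (T g y) ≤ actDW T x y := by
  refine iSup₂_le fun Φ hΦ => ?_
  refine le_trans (le_of_eq ?_) (actDFol_le_actDW (hΦ.image_mul_right g) x y)
  have hinj : Function.Injective fun t : G => t * g := mul_left_injective g
  simp only [actDFol, hTmul, Finset.card_image_of_injective _ hinj,
    Finset.sum_image hinj.injOn]

theorem actDW_le_add {x y z : K} {a b : ℝ≥0∞} (hxy : actDW T x y < a) (hyz : actDW T y z < b) :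
    actDW T x z ≤ a + b := by
  refine iSup₂_le fun Φ hΦ => ?_
  have h₁ := eventually_lt_of_limsup_lt ((actDFol_le_actDW hΦ x y).trans_lt hxy)
  have h₂ := eventually_lt_of_limsup_lt ((actDFol_le_actDW hΦ y z).trans_lt hyz)
  refine limsup_le_of_le (by isBoundedDefault) ?_
  filter_upwards [h₁, h₂] with n hn₁ hn₂
  refine le_trans ?_ (add_le_add hn₁.le hn₂.le)
  rw [← ENNReal.add_div, ← Finset.sum_add_distrib]
  exact ENNReal.div_le_div_right (Finset.sum_le_sum fun t _ => edist_triangle _ _ _) _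

variable (T) in
/-- The points with a neighbourhood on which the Weyl pseudometric is uniformly `< ε`. -/
def actEE (ε : ℝ) : Set K :=
  {x | ∃ U : Set K, IsOpen U ∧ x ∈ U ∧ ∀ y ∈ U, ∀ z ∈ U, actDW T y z < ENNReal.ofReal ε}

theorem isOpen_actEE (ε : ℝ) : IsOpen (actEE T ε) := by
  refine isOpen_iff_mem_nhds.2 fun x ⟨U, hU, hxU, hlt⟩ => ?_
  filter_upwards [hU.mem_nhds hxU] with y hy using ⟨U, hU, hy, hlt⟩

theorem mem_actEE_of_apply_mem (hTmul : ∀ (g₁ g₂ : G) (x : K), T g₂ (T g₁ x) = T (g₂ * g₁) x)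
    (hT1 : ∀ x : K, T 1 x = x) (hTc : ∀ g : G, Continuous (T g)) {ε : ℝ} {g : G} {x : K}
    (hx : T g x ∈ actEE T ε) : x ∈ actEE T ε := by
  obtain ⟨U, hU, hxU, hlt⟩ := hx
  refine ⟨T g ⁻¹' U, hU.preimage (hTc g), hxU, fun y hy z hz => ?_⟩
  have hle := actDW_apply_le hTmul g⁻¹ (T g y) (T g z)
  simp only [hTmul, inv_mul_cancel, hT1] at hle
  exact hle.trans_lt (hlt _ hy _ hz)

theorem actMeanEqPts_subset_actEE {ε : ℝ} (hε : 0 < ε) : actMeanEqPts T ⊆ actEE T ε := by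
  intro x hx
  obtain ⟨δ, hδ, hlt⟩ := hx (ε / 3) (by positivity)
  refine ⟨ball x δ, isOpen_ball, mem_ball_self hδ, fun y hy z hz => ?_⟩
  have hxy := hlt y (mem_ball'.1 hy)
  rw [actDW_comm] at hxy
  refine (actDW_le_add hxy (hlt z (mem_ball'.1 hz))).trans_lt ?_
  rw [← ENNReal.ofReal_add (by positivity) (by positivity)]
  exact (ENNReal.ofReal_lt_ofReal_iff hε).2 (by linarith)

theorem mem_actMeanEqPts_of_forall_mem_actEE {x : K}
    (hx : ∀ n : ℕ, x ∈ actEE T (1 / ((n : ℝ) + 1))) : x ∈ actMeanEqPts T := by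
  intro ε hε
  obtain ⟨n, hn⟩ := exists_nat_one_div_lt hε
  obtain ⟨U, hU, hxU, hlt⟩ := hx n
  obtain ⟨δ, hδ, hball⟩ := Metric.isOpen_iff.1 hU x hxU
  exact ⟨δ, hδ, fun y hy => (hlt x hxU y (hball (mem_ball'.2 hy))).trans_le
    (ENNReal.ofReal_le_ofReal hn.le)⟩

end WeylPseudometric

/-- For a transitive action of a countable amenable group on a nonempty
compact metric space, the set `𝔼` of Weyl-mean equicontinuous points is either empty or
residual; and if the action is almost Weyl-mean equicontinuous then every transitive point
is a Weyl-mean equicontinuous point. -/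
theorem transitive_action_meanEqPts_empty_or_residual
    {G : Type*} [Group G] [Countable G]
    {K : Type*} [MetricSpace K] [CompactSpace K] [Nonempty K]
    (hG : ∃ Φ : ℕ → Finset G, IsFolner Φ)
    (T : G → K → K)
    (hT1 : ∀ x : K, T 1 x = x)
    (hTmul : ∀ (g₁ g₂ : G) (x : K), T g₂ (T g₁ x) = T (g₂ * g₁) x)
    (hTc : ∀ g : G, Continuous (T g))
    (htrans : ∀ U V : Set K, IsOpen U → IsOpen V → U.Nonempty → V.Nonempty →
      ∃ s : G, ((T s '' U) ∩ V).Nonempty) :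
    (actMeanEqPts T = ∅ ∨
      ∃ U : ℕ → Set K, (∀ n, IsOpen (U n)) ∧ (∀ n, Dense (U n)) ∧
        (⋂ n, U n) ⊆ actMeanEqPts T) ∧
    ((actMeanEqPts T).Nonempty →
      ∀ x : K, Dense (Set.range fun g : G => T g x) → x ∈ actMeanEqPts T) := by
  have hne : ∀ n : ℕ, (actMeanEqPts T).Nonempty → (actEE T (1 / ((n : ℝ) + 1))).Nonempty :=
    fun n h => h.mono (actMeanEqPts_subset_actEE (by positivity))
  refine ⟨(actMeanEqPts T).eq_empty_or_nonempty.imp_right fun h => ?_, fun h x hx => ?_⟩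
  · refine ⟨fun n => actEE T (1 / ((n : ℝ) + 1)), fun n => isOpen_actEE _, fun n => ?_,
      fun x hx => mem_actMeanEqPts_of_forall_mem_actEE (Set.mem_iInter.1 hx)⟩
    refine dense_iff_inter_open.2 fun U hU hUne => ?_
    obtain ⟨s, -, ⟨x, hxU, rfl⟩, hx⟩ := htrans U _ hU (isOpen_actEE _) hUne (hne n h)
    exact ⟨x, hxU, mem_actEE_of_apply_mem hTmul hT1 hTc hx⟩
  · refine mem_actMeanEqPts_of_forall_mem_actEE fun n => ?_
    obtain ⟨-, hmem, g, rfl⟩ := hx.inter_open_nonempty _ (isOpen_actEE _) (hne n h)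
    exact mem_actEE_of_apply_mem hTmul hT1 hTc hmem
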